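/- arXiv:math/0211455 — 5 statements merged into one kernel-verified Lean document; each statement's English description precedes it below -/
import Mathlib

section
/- Let S be a finite non-equidistant subset of a metric space with at least two points, and let f : S → S be the nearest-neighbor map. If x ∈ S and n ≥ 1 satisfy f^n(x) = x (the n-fold iterate of f returns to x), then f(f(x)) = x. In other words, every cycle of the nearest-neighbor map has length 2. -/
/-- A subset `S` of a metric space is non-equidistant if distinct pairs of points of `S`
determine distinct positive distances. -/
def NonEquidistant {X : Type*} [MetricSpace X] (S : Set X) : Prop :=
  ∀ w ∈ S, ∀ x ∈ S, ∀ y ∈ S, ∀ z ∈ S,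
    w ≠ x → y ≠ z → ({w, x} : Set X) ≠ {y, z} → dist w x ≠ dist y z

/-- Every cycle of the nearest-neighbor map of a finite non-equidistant set with at
least two points has length two: if some iterate of `f` returns `x` to itself, then
already `f (f x) = x`. -/
theorem nearest_neighbor_cycles_length_two {X : Type*} [MetricSpace X] (S : Set X)
    (hfin : S.Finite) (h2 : ∃ x ∈ S, ∃ y ∈ S, x ≠ y) (hne : NonEquidistant S)
    (f : X → X)
    (hfS : ∀ x ∈ S, f x ∈ S)
    (hfne : ∀ x ∈ S, f x ≠ x)
    (hfmin : ∀ x ∈ S, ∀ z ∈ S, z ≠ x → dist x (f x) ≤ dist x z)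
    (x : X) (hx : x ∈ S) (n : ℕ) (hn : 1 ≤ n) (hcyc : f^[n] x = x) :
    f (f x) = x := by
  have hS : ∀ k, f^[k] x ∈ S := by
    intro k
    induction k with
    | zero => exact hx
    | succ k ih => rw [Function.iterate_succ_apply']; exact hfS _ ih
  have hanti : Antitone (fun k => dist (f^[k] x) (f (f^[k] x))) := by
    refine antitone_nat_of_succ_le fun k => ?_
    simp only [Function.iterate_succ_apply']
    have h := hfmin _ (hfS _ (hS k)) _ (hS k) (hfne _ (hS k)).symm
    rwa [dist_comm (f (f^[k] x)) (f^[k] x)] at h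
  have h1 : dist (f x) (f (f x)) ≤ dist x (f x) := hanti (Nat.zero_le 1)
  have h3 : dist x (f x) ≤ dist (f x) (f (f x)) := by
    have h := hanti hn
    simp only [hcyc] at h
    exact h
  have hfx := hfS x hx
  have hffx := hfS _ hfx
  by_contra hc
  refine hne x hx (f x) hfx (f x) hfx (f (f x)) hffx (hfne x hx).symm
    (hfne _ hfx).symm ?_ (le_antisymm h3 h1)
  intro hset
  have hm : f (f x) ∈ ({x, f x} : Set X) := by rw [hset]; simp
  rcases hm with h | h
  · exact hc h
  · exact hfne _ hfx h
end

section
/- Let S be a finite non-equidistant subset of a metric space with at least two points, and let f : S → S be the nearest-neighbor map. Then for every x ∈ S there exists n ≥ 0 with f^{n+2}(x) = f^n(x); that is, the orbit of every point under iteration of f eventually alternates between two points, and these two points are mutually closest in S. -/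
/-- The orbit of every point of a finite non-equidistant set under the nearest-neighbor
map `f` eventually alternates between two distinct points, and these two points are
mutually closest (each is the nearest neighbor of the other). -/
theorem nearest_neighbor_orbit_alternates {X : Type*} [MetricSpace X] (S : Set X)
    (hfin : S.Finite) (h2 : ∃ x ∈ S, ∃ y ∈ S, x ≠ y) (hne : NonEquidistant S)
    (f : X → X)
    (hfS : ∀ x ∈ S, f x ∈ S)
    (hfne : ∀ x ∈ S, f x ≠ x)
    (hfmin : ∀ x ∈ S, ∀ z ∈ S, z ≠ x → dist x (f x) ≤ dist x z)
    (x : X) (hx : x ∈ S) :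
    ∃ n : ℕ, f^[n + 2] x = f^[n] x ∧
      f^[n] x ≠ f^[n + 1] x ∧
      f (f^[n] x) = f^[n + 1] x ∧
      f (f^[n + 1] x) = f^[n] x := by
  have horb : ∀ n, f^[n] x ∈ S := by
    intro n
    induction n with
    | zero => exact hx
    | succ k ih =>
      rw [Function.iterate_succ_apply']
      exact hfS _ ih
  have hTfin : (Set.range (fun n : ℕ => f^[n] x)).Finite :=
    hfin.subset (by rintro _ ⟨n, rfl⟩; exact horb n)
  obtain ⟨y, ⟨n, hn⟩, hmin⟩ := Set.exists_min_image _ (fun y => dist y (f y)) hTfin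
    ⟨x, ⟨0, rfl⟩⟩
  have hn' : f^[n] x = y := hn
  have hyS : y ∈ S := hn' ▸ horb n
  have h1 : f^[n + 1] x = f y := by rw [Function.iterate_succ_apply', hn']
  have h3 : f^[n + 2] x = f (f y) := by rw [Function.iterate_succ_apply', h1]
  have hle : dist y (f y) ≤ dist (f y) (f (f y)) := hmin (f y) ⟨n + 1, h1⟩
  have hge : dist (f y) (f (f y)) ≤ dist (f y) y :=
    hfmin _ (hfS y hyS) y hyS (hfne y hyS).symm
  rw [dist_comm (f y) y] at hge
  have key : f (f y) = y := by
    by_contra hc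
    refine hne y hyS (f y) (hfS y hyS) (f y) (hfS y hyS) (f (f y)) (hfS _ (hfS y hyS))
      (hfne y hyS).symm (hfne _ (hfS y hyS)).symm ?_ (le_antisymm hle hge)
    intro he
    have hm : y ∈ ({f y, f (f y)} : Set X) := he ▸ Set.mem_insert _ _
    rcases hm with h | h
    · exact hfne y hyS h.symm
    · exact hc (Set.mem_singleton_iff.mp h).symm
  refine ⟨n, ?_, ?_, ?_, ?_⟩
  · rw [h3, hn', key]
  · rw [hn', h1]
    exact (hfne y hyS).symm
  · rw [hn', h1]
  · rw [h1, hn', key]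
end

section
/- Let V be a set, and for each k ∈ ℕ let ≈_k be an equivalence relation on V and ℓ_k : V → V a function, satisfying: (a) if x ≈_k y then x ≈_{k+1} y; (b) every equivalence class of every ≈_k is finite; (c) for all x, y ∈ V there exists k with x ≈_k y; (d) ℓ_k(x) ≈_k x for all k, x; (e) if x ≈_k y then ℓ_k(x) = ℓ_k(y); (f) ℓ_k(ℓ_{k+1}(x)) = ℓ_{k+1}(x) for all k, x. Define a simple graph G on vertex set V by joining distinct x, y whenever y = ℓ_0(x) or x = ℓ_0(y), or there exists k with (x = ℓ_k(x) and y = ℓ_{k+1}(x)) or (y = ℓ_k(y) and x = ℓ_{k+1}(y)). Then G has at most one end: for every finite set F ⊆ V, the subgraph of G induced on V \ F has at most one infinite connected component. -/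
/-- Given a connected, locally finite clumping of a set `V` (successively coarser
equivalence relations `eqv k` with finite classes, eventually relating any two points)
together with a compatible choice of leaders `ℓ k`, the associated leader graph has at
most one end: deleting any finite set of vertices leaves at most one infinite connected
component. -/
theorem clumping_leader_graph_one_ended {V : Type*}
    (eqv : ℕ → V → V → Prop) (ℓ : ℕ → V → V)
    (hequiv : ∀ k, Equivalence (eqv k))
    (hcoarser : ∀ k x y, eqv k x y → eqv (k + 1) x y)
    (hfin : ∀ k x, {y | eqv k x y}.Finite)
    (hconn : ∀ x y, ∃ k, eqv k x y)
    (hmem : ∀ k x, eqv k (ℓ k x) x)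
    (hconst : ∀ k x y, eqv k x y → ℓ k x = ℓ k y)
    (hleader : ∀ k x, ℓ k (ℓ (k + 1) x) = ℓ (k + 1) x) :
    ∀ F : Set V, F.Finite →
      ∀ C D : ((SimpleGraph.fromRel (fun x y =>
          y = ℓ 0 x ∨ ∃ k, x = ℓ k x ∧ y = ℓ (k + 1) x)).induce Fᶜ).ConnectedComponent,
        {v | ((SimpleGraph.fromRel (fun x y =>
          y = ℓ 0 x ∨ ∃ k, x = ℓ k x ∧ y = ℓ (k + 1) x)).induce
            Fᶜ).connectedComponentMk v = C}.Infinite →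
        {v | ((SimpleGraph.fromRel (fun x y =>
          y = ℓ 0 x ∨ ∃ k, x = ℓ k x ∧ y = ℓ (k + 1) x)).induce
            Fᶜ).connectedComponentMk v = D}.Infinite →
        C = D := by
  intro F hF C D hC hD
  have hmono : ∀ j k, j ≤ k → ∀ x y, eqv j x y → eqv k x y := by
    intro j k hjk
    induction hjk with
    | refl => exact fun x y h => h
    | step _ ih => exact fun x y h => hcoarser _ x y (ih x y h)
  have hsymm : ∀ k x y, eqv k x y → eqv k y x := fun k x y h => (hequiv k).symm h
  have htrans : ∀ k x y z, eqv k x y → eqv k y z → eqv k x z :=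
    fun k x y z h h' => (hequiv k).trans h h'
  have hll : ∀ k x, ℓ k (ℓ k x) = ℓ k x := fun k x => hconst k _ _ (hmem k x)
  have hdown : ∀ j k, j ≤ k → ∀ x, ℓ k x = x → ℓ j x = x := by
    intro j k hjk
    induction hjk with
    | refl => exact fun x h => h
    | @step m _ ih =>
      intro x h
      apply ih
      have := hleader m x
      rw [Nat.succ_eq_add_one] at h
      rwa [h] at this
  obtain ⟨b, -⟩ := hC.nonempty
  obtain ⟨b, -⟩ := b
  have hK : ∃ K, ∀ f ∈ F, eqv K f b := by
    choose g hg using fun f => hconn f b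
    obtain ⟨K, hK⟩ := (hF.image g).bddAbove
    exact ⟨K, fun f hf => hmono _ _ (hK ⟨f, hf, rfl⟩) _ _ (hg f)⟩
  obtain ⟨K, hK⟩ := hK
  -- an infinite component has a vertex outside any clump
  have hout : ∀ (S : Set (Fᶜ : Set V)), S.Infinite → ∀ k x, ∃ v ∈ S, ¬ eqv k x v.1 := by
    intro S hS k x
    by_contra! hcon
    exact hS (((hfin k x).preimage Subtype.val_injective.injOn).subset
      (fun v hv => hcon v hv))
  by_cases hcase : ∃ k, K ≤ k ∧ ℓ k b ∉ F
  · obtain ⟨N, hKN, hN⟩ := hcase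
    have hFN : ∀ f ∈ F, eqv N f b := fun f hf => hmono _ _ hKN _ _ (hK f hf)
    have hb : ∀ j, N ≤ j → ℓ j b ∉ F := by
      intro j hj hjF
      have h1 := hdown N j hj _ (hll j b)
      rw [hconst N _ _ (hFN _ hjF)] at h1
      exact hN (h1 ▸ hjF)
    have hclimb : ∀ v, ¬ eqv N b v → ∀ k, ℓ k v ∈ Fᶜ := by
      intro v hv k hk
      have h1 := hFN _ hk
      have h2 := hsymm _ _ _ (hmem k v)
      rcases le_total k N with h | h
      · exact hv (hsymm _ _ _ (htrans _ _ _ _ (hmono _ _ h _ _ h2) h1))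
      · have h3 := htrans _ _ _ _ h2 (hmono _ _ h _ _ h1)
        rw [hconst k _ _ h3] at hk
        exact hb k h hk
    have hreach : ∀ (v : (Fᶜ : Set V)) (hv : ¬ eqv N b v.1) (k : ℕ),
        ((SimpleGraph.fromRel (fun x y =>
          y = ℓ 0 x ∨ ∃ k, x = ℓ k x ∧ y = ℓ (k + 1) x)).induce Fᶜ).Reachable
          v ⟨ℓ k v.1, hclimb v.1 hv k⟩ := by
      intro v hv k
      induction k with
      | zero =>
        by_cases h : v.1 = ℓ 0 v.1
        · have : v = ⟨ℓ 0 v.1, hclimb v.1 hv 0⟩ := Subtype.ext h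
          rw [← this]
        · apply SimpleGraph.Adj.reachable
          rw [SimpleGraph.comap_adj, SimpleGraph.fromRel_adj]
          exact ⟨h, Or.inl (Or.inl rfl)⟩
      | succ k ih =>
        refine ih.trans ?_
        by_cases h : ℓ k v.1 = ℓ (k + 1) v.1
        · have : (⟨ℓ k v.1, hclimb v.1 hv k⟩ : (Fᶜ : Set V))
            = ⟨ℓ (k + 1) v.1, hclimb v.1 hv (k + 1)⟩ := Subtype.ext h
          rw [← this]
        · apply SimpleGraph.Adj.reachable
          rw [SimpleGraph.comap_adj, SimpleGraph.fromRel_adj]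
          exact ⟨h, Or.inl (Or.inr ⟨k, (hll k _).symm,
            (hconst (k + 1) _ _ (hcoarser _ _ _ (hmem k v.1))).symm⟩)⟩
    obtain ⟨v, hvC, hv⟩ := hout _ hC N b
    obtain ⟨w, hwD, hw⟩ := hout _ hD N b
    obtain ⟨k, hk⟩ := hconn v.1 w.1
    have h1 := hreach v hv k
    have h2 := hreach w hw k
    have h3 : (⟨ℓ k v.1, hclimb v.1 hv k⟩ : (Fᶜ : Set V))
      = ⟨ℓ k w.1, hclimb w.1 hw k⟩ := Subtype.ext (hconst k _ _ hk)
    rw [h3] at h1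
    rw [Set.mem_setOf_eq] at hvC hwD
    rw [← hvC, ← hwD, SimpleGraph.ConnectedComponent.eq]
    exact h1.trans h2.symm
  · exfalso
    push Not at hcase
    obtain ⟨v, hvC, hv⟩ := hout _ hC K b
    have hp : ∃ p, K ≤ p ∧ ¬ eqv p b v.1 ∧ eqv (p + 1) b v.1 := by
      by_contra! hcon
      obtain ⟨k, hk⟩ := hconn b v.1
      have : ∀ n, ¬ eqv (K + n) b v.1 := by
        intro n
        induction n with
        | zero => exact hv
        | succ n ih => exact hcon (K + n) (by omega) ih
      exact this k (hmono _ _ (by omega) _ _ hk)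
    obtain ⟨p, hKp, -, hpv⟩ := hp
    have key : ∀ x y, x ∉ F → y ∉ F → (y = ℓ 0 x ∨ ∃ k, x = ℓ k x ∧ y = ℓ (k + 1) x) →
        (eqv p v.1 x ∨ eqv p v.1 y) → eqv p x y := by
      intro x y hx hy h hxy
      rcases h with h | ⟨k, -, h⟩
      · rw [h]
        exact hsymm _ _ _ (hmono 0 p (by omega) _ _ (hmem 0 x))
      · have hm := hmem (k + 1) x
        rw [← h] at hm
        rcases le_or_gt (k + 1) p with hk | hk
        · exact hsymm _ _ _ (hmono _ _ hk _ _ hm)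
        · exfalso
          have hbx : eqv (k + 1) b x := by
            have h1 := hmono _ (k + 1) (by omega) _ _ hpv
            rcases hxy with h' | h'
            · exact htrans _ _ _ _ h1 (hmono _ _ hk.le _ _ h')
            · exact htrans _ _ _ _ (htrans _ _ _ _ h1 (hmono _ _ hk.le _ _ h')) hm
          apply hy
          rw [h, ← hconst _ _ _ hbx]
          exact hcase _ (by omega)
    obtain ⟨w, hwC, hw⟩ := hout _ hC p v.1
    rw [Set.mem_setOf_eq] at hvC hwC
    rw [← hvC, SimpleGraph.ConnectedComponent.eq, SimpleGraph.reachable_comm,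
      SimpleGraph.reachable_iff_reflTransGen] at hwC
    apply hw
    clear hw
    induction hwC with
    | refl => exact (hequiv p).refl _
    | @tail x y _ hadj ih =>
      rw [SimpleGraph.comap_adj, SimpleGraph.fromRel_adj] at hadj
      rcases hadj.2 with h | h
      · exact htrans _ _ _ _ ih (key _ _ x.2 y.2 h (Or.inl ih))
      · exact htrans _ _ _ _ ih (hsymm _ _ _ (key _ _ y.2 x.2 h (Or.inr ih)))
end

section
/- Let T be a locally finite tree with exactly two ends, on vertex set V. Then there exists an injective sequence (v_n)_{n∈ℤ} of vertices with v_n adjacent to v_{n+1} for every n ∈ ℤ (a doubly infinite self-avoiding path, called the trunk); the vertex set W = {v_n : n ∈ ℤ} is the same for every such doubly infinite self-avoiding path in T; and every connected component of the subgraph of T induced on V \ W is finite. -/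
/-- A graph has exactly two ends if deleting any finite set of vertices leaves at most
two infinite connected components, and deleting some finite set leaves at least two. -/
def SimpleGraph.TwoEnded {V : Type*} (G : SimpleGraph V) : Prop :=
  (∀ F : Set V, F.Finite →
    ∀ C D E : (G.induce Fᶜ).ConnectedComponent,
      {v | (G.induce Fᶜ).connectedComponentMk v = C}.Infinite →
      {v | (G.induce Fᶜ).connectedComponentMk v = D}.Infinite →
      {v | (G.induce Fᶜ).connectedComponentMk v = E}.Infinite →
      C = D ∨ C = E ∨ D = E) ∧
  (∃ F : Set V, F.Finite ∧
    ∃ C D : (G.induce Fᶜ).ConnectedComponent, C ≠ D ∧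
      {v | (G.induce Fᶜ).connectedComponentMk v = C}.Infinite ∧
      {v | (G.induce Fᶜ).connectedComponentMk v = D}.Infinite)

namespace TrunkAux
open SimpleGraph

variable {V : Type*} {T : SimpleGraph V}

/-- The branch at `u` through the neighbour `w`. -/
def Br (T : SimpleGraph V) (u w : V) : Set V := {x | T.dist u x = T.dist w x + 1}

lemma mem_Br {u w x : V} : x ∈ Br T u w ↔ T.dist u x = T.dist w x + 1 := Iff.rfl

lemma pred_exists (h : T.IsTree) {o y : V} (hne : o ≠ y) :
    ∃ x, T.Adj x y ∧ T.dist o y = T.dist o x + 1 := by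
  obtain ⟨p, hp⟩ := h.1.exists_walk_length_eq_dist y o
  cases p with
  | nil => exact absurd rfl hne
  | @cons _ x _ hadj q =>
    refine ⟨x, hadj.symm, ?_⟩
    have h1 : T.dist x o ≤ q.length := dist_le q
    have h2 : T.dist y o ≤ T.dist y x + T.dist x o := h.1.dist_triangle
    have h3 : T.dist y x = 1 := dist_eq_one_iff_adj.2 hadj
    simp only [Walk.length_cons] at hp
    rw [dist_comm (u := o), dist_comm (u := o)]
    omega

lemma pred_unique (h : T.IsTree) {o y x x' : V} (hx : T.Adj x y) (hx' : T.Adj x' y)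
    (d : T.dist o y = T.dist o x + 1) (d' : T.dist o y = T.dist o x' + 1) : x = x' := by
  obtain ⟨p, hp⟩ := h.1.exists_walk_length_eq_dist x o
  obtain ⟨q, hq⟩ := h.1.exists_walk_length_eq_dist x' o
  have h1 : (Walk.cons hx.symm p).IsPath := by
    apply Walk.isPath_of_length_eq_dist
    rw [Walk.length_cons, hp, dist_comm, ← d, dist_comm]
  have h2 : (Walk.cons hx'.symm q).IsPath := by
    apply Walk.isPath_of_length_eq_dist
    rw [Walk.length_cons, hq, dist_comm, ← d', dist_comm]
  have := (h.existsUnique_path y o).unique h1 h2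
  injection this

lemma adj_dist (h : T.IsTree) (o : V) {x y : V} (hx : T.Adj x y) :
    T.dist o x = T.dist o y + 1 ∨ T.dist o y = T.dist o x + 1 := by
  have := h.dist_eq_dist_add_one_of_adj o hx
  omega

lemma Br_or (h : T.IsTree) {u w : V} (hu : T.Adj u w) (x : V) : x ∈ Br T u w ∨ x ∈ Br T w u := by
  have := adj_dist h x hu
  simp only [mem_Br]
  rw [dist_comm (u := u), dist_comm (u := w)]
  exact this

lemma Br_not {u w x : V} (h1 : x ∈ Br T u w) (h2 : x ∈ Br T w u) : False := by
  rw [mem_Br] at *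
  omega

lemma Br_self {u w : V} (hu : T.Adj u w) : w ∈ Br T u w := by
  rw [mem_Br, dist_self, dist_eq_one_iff_adj.2 hu]

/-- leaving a branch -/
lemma Br_cross (h : T.IsTree) {u w x y : V} (hu : T.Adj u w) (hx : x ∈ Br T u w)
    (hxy : T.Adj x y) (hy : y ∉ Br T u w) : x = w ∧ y = u := by
  have hy := (Br_or h hu y).resolve_left hy
  rw [mem_Br] at hx hy
  have a1 := adj_dist h w hxy
  have a2 := adj_dist h u hxy
  by_cases hd : u = y
  · subst hd
    rw [dist_self] at hy a2
    have : T.dist w x = 0 := by omega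
    exact ⟨(h.1.dist_eq_zero_iff.1 this).symm, rfl⟩
  · exfalso
    obtain ⟨z, hz, hzd⟩ := pred_exists h hd
    have a3 := adj_dist h w hz
    have a4 := adj_dist h z hu
    rw [dist_comm (v := u), dist_comm (v := w)] at a4
    have : x = z := pred_unique h (o := w) hxy hz (by omega) (by omega)
    subst this
    omega

lemma Br_reach (h : T.IsTree) {u w : V} (hu : T.Adj u w) {S : Set V} (hS : Br T u w ⊆ S) :
    ∀ n, ∀ x (hx : x ∈ Br T u w), T.dist w x = n →
      (T.induce S).Reachable ⟨x, hS hx⟩ ⟨w, hS (Br_self hu)⟩ := by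
  intro n
  induction n with
  | zero =>
    intro x hx hd
    have : w = x := h.1.dist_eq_zero_iff.1 hd
    subst this
    exact Reachable.refl _
  | succ n ih =>
    intro x hx hd
    have hne : w ≠ x := by
      rintro rfl
      simp at hd
    obtain ⟨z, hz, hzd⟩ := pred_exists h hne
    have hzB : z ∈ Br T u w := by
      by_contra hc
      have := Br_cross h hu hx hz.symm hc
      exact hne this.1.symm
    have := ih z hzB (by omega)
    refine Reachable.trans (Adj.reachable ?_) this
    simpa using hz.symm

/-- Closed sets under adjacency contain reachable components. -/
lemma reach_mem {S A : Set V} (hA : ∀ x ∈ A, ∀ y ∈ S, T.Adj x y → y ∈ A) {x y : S}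
    (hr : (T.induce S).Reachable x y) (hx : (x : V) ∈ A) : (y : V) ∈ A := by
  obtain ⟨p⟩ := hr
  induction p with
  | nil => exact hx
  | @cons a b c hab q ih => exact ih (hA _ hx _ b.2 (by simpa using hab))

lemma Br_exists (h : T.IsTree) {w x : V} (hne : x ≠ w) : ∃ w', T.Adj w w' ∧ x ∈ Br T w w' := by
  obtain ⟨z, hz, hzd⟩ := pred_exists h hne
  exact ⟨z, hz.symm, by rw [mem_Br, dist_comm, hzd, dist_comm]⟩

lemma Br_sub (h : T.IsTree) {u w w' : V} (hu : T.Adj u w) (hw : T.Adj w w') (hne : w' ≠ u) :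
    Br T w w' ⊆ Br T u w := by
  intro x hx
  refine (Br_or h hu x).resolve_right fun hc => hne ?_
  rw [mem_Br] at hx hc
  refine pred_unique h (o := x) hw.symm hu ?_ ?_
  · rw [dist_comm, hx, dist_comm]
  · rw [dist_comm, hc, dist_comm]

lemma koenig0 (h : T.IsTree) (hlf : ∀ v, (T.neighborSet v).Finite) (w : V) (A : Set V)
    (hA : A.Infinite) : ∃ w', T.Adj w w' ∧ (A ∩ Br T w w').Infinite := by
  by_contra! hc
  apply hA
  have : A ⊆ {w} ∪ ⋃ w' ∈ T.neighborSet w, (A ∩ Br T w w') := by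
    intro x hx
    by_cases hxw : x = w
    · left; exact hxw
    · right
      obtain ⟨w', h1, h2⟩ := Br_exists h hxw
      simp only [Set.mem_iUnion]
      exact ⟨w', h1, hx, h2⟩
  refine Set.Finite.subset ((Set.finite_singleton w).union ((hlf w).biUnion ?_)) this
  intro w' hw'
  exact Set.not_infinite.1 (by simpa using hc w' hw')

lemma koenig (h : T.IsTree) (hlf : ∀ v, (T.neighborSet v).Finite) {u w : V}
    (hA : (Br T u w).Infinite) : ∃ w', T.Adj w w' ∧ w' ≠ u ∧ (Br T w w').Infinite := by
  obtain ⟨w', h1, h2⟩ := koenig0 h hlf w _ hA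
  refine ⟨w', h1, ?_, h2.mono Set.inter_subset_right⟩
  rintro rfl
  obtain ⟨x, hx⟩ := h2.nonempty
  exact Br_not hx.1 hx.2

lemma three (h : T.IsTree) (h2 : T.TwoEnded) {w a b c : V} (ha : T.Adj w a) (hb : T.Adj w b)
    (hc : T.Adj w c) (ia : (Br T w a).Infinite) (ib : (Br T w b).Infinite)
    (ic : (Br T w c).Infinite) : a = b ∨ a = c ∨ b = c := by
  have hS : ∀ a, T.Adj w a → Br T w a ⊆ ({w} : Set V)ᶜ := by
    rintro a ha x hx rfl
    rw [mem_Br, dist_self] at hx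
    omega
  have key : ∀ a (ha : T.Adj w a), (Br T w a).Infinite →
      {v | (T.induce ({w} : Set V)ᶜ).connectedComponentMk v =
        (T.induce ({w} : Set V)ᶜ).connectedComponentMk ⟨a, hS a ha (Br_self ha)⟩}.Infinite := by
    intro a ha ia hf
    apply ia
    refine (hf.image Subtype.val).subset ?_
    intro x hx
    exact ⟨⟨x, hS a ha hx⟩, ConnectedComponent.sound (Br_reach h ha (hS a ha) _ x hx rfl), rfl⟩
  have key2 : ∀ a b (ha : T.Adj w a) (hb : T.Adj w b),
      (T.induce ({w} : Set V)ᶜ).connectedComponentMk ⟨a, hS a ha (Br_self ha)⟩ =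
        (T.induce ({w} : Set V)ᶜ).connectedComponentMk ⟨b, hS b hb (Br_self hb)⟩ → a = b := by
    intro a b ha hb hab
    have hr := ConnectedComponent.exact hab
    have := reach_mem (A := Br T w a) (fun x hx y hy hxy => by
      by_contra hc
      exact hy (Br_cross h ha hx hxy hc).2) hr (Br_self ha)
    have this : T.dist w b = T.dist a b + 1 := this
    rw [dist_eq_one_iff_adj.2 hb] at this
    exact h.1.dist_eq_zero_iff.1 (by omega)
  rcases h2.1 {w} (Set.finite_singleton w) _ _ _ (key a ha ia) (key b hb ib) (key c hc ic) with
    e | e | e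
  · exact Or.inl (key2 _ _ ha hb e)
  · exact Or.inr (Or.inl (key2 _ _ ha hc e))
  · exact Or.inr (Or.inr (key2 _ _ hb hc e))

lemma Br_far (h : T.IsTree) {o u w : V} (hu : T.Adj u w) (ho : o ∉ Br T u w) :
    ∀ n x, x ∈ Br T u w → T.dist o x = n → T.dist o w ≤ n := by
  intro n
  induction n with
  | zero =>
    intro x hx hd
    have : o = x := h.1.dist_eq_zero_iff.1 hd
    subst this
    exact absurd hx ho
  | succ n ih =>
    intro x hx hd
    have hne : o ≠ x := by
      rintro rfl
      exact ho hx
    obtain ⟨z, hz, hzd⟩ := pred_exists h hne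
    by_cases hzB : z ∈ Br T u w
    · have := ih z hzB (by omega)
      omega
    · have := (Br_cross h hu hx hz.symm hzB).1
      subst this
      omega

lemma far_edge (h : T.IsTree) (hlf : ∀ v, (T.neighborSet v).Finite)
    (hinf : (Set.univ : Set V).Infinite) (o : V) (n : ℕ) :
    ∃ u w, T.Adj u w ∧ (Br T u w).Infinite ∧ T.dist o u = n ∧ T.dist o w = n + 1 := by
  induction n with
  | zero =>
    obtain ⟨w, h1, h2⟩ := koenig0 h hlf o _ hinf
    exact ⟨o, w, h1, h2.mono Set.inter_subset_right, dist_self, by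
      rw [dist_eq_one_iff_adj.2 h1]⟩
  | succ n ih =>
    obtain ⟨u, w, h1, h2, h3, h4⟩ := ih
    obtain ⟨w', h5, h6, h7⟩ := koenig h hlf h2
    refine ⟨w, w', h5, h7, h4, ?_⟩
    rcases adj_dist h o h5 with h8 | h8
    · exact absurd (pred_unique h (o := o) h5.symm h1 (by omega) (by omega)) h6
    · omega

lemma trunk_edge (h : T.IsTree) (hlf : ∀ v, (T.neighborSet v).Finite) (h2 : T.TwoEnded) :
    ∃ a b, T.Adj a b ∧ (Br T a b).Infinite ∧ (Br T b a).Infinite := by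
  obtain ⟨F, hF, C, D, hCD, iC, iD⟩ := h2.2
  by_contra! hno
  have iC' := iC.image (f := Subtype.val) Subtype.val_injective.injOn
  have iD' := iD.image (f := Subtype.val) Subtype.val_injective.injOn
  obtain ⟨o, -⟩ := iC'.nonempty
  obtain ⟨n, hn⟩ := (hF.image (T.dist o)).bddAbove
  obtain ⟨u, w, h1, h3, h4, h5⟩ := far_edge h hlf (iC'.mono (Set.subset_univ _)) o n
  have hfin : (Br T w u).Finite := Set.not_infinite.1 (by simpa using hno u w h1 h3)
  have ho : o ∉ Br T u w := by
    rw [mem_Br, dist_comm, h4, dist_comm, h5]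
    omega
  have hS : Br T u w ⊆ Fᶜ := by
    intro x hx hxF
    have q1 := Br_far h h1 ho _ x hx rfl
    have q2 := hn ⟨x, hxF, rfl⟩
    omega
  have key : ∀ C : (T.induce Fᶜ).ConnectedComponent,
      (Subtype.val '' {v | (T.induce Fᶜ).connectedComponentMk v = C}).Infinite →
      C = (T.induce Fᶜ).connectedComponentMk ⟨w, hS (Br_self h1)⟩ := by
    intro C iC
    obtain ⟨_, ⟨x, hx, rfl⟩, hxB⟩ := (iC.sdiff hfin).nonempty
    have hxB := (Br_or h h1 x).resolve_right hxB
    rw [← hx]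
    exact ConnectedComponent.sound (Br_reach h h1 hS _ x hxB rfl)
  exact hCD ((key C iC').trans (key D iD').symm)

lemma ray (h : T.IsTree) (hlf : ∀ v, (T.neighborSet v).Finite) {a b : V} (hab : T.Adj a b)
    (hi : (Br T a b).Infinite) : ∃ r : ℕ → V, r 0 = a ∧ r 1 = b ∧
      (∀ n, T.Adj (r n) (r (n + 1))) ∧ ∀ n, r (n + 2) ≠ r n := by
  have step : ∀ p : {p : V × V // T.Adj p.1 p.2 ∧ (Br T p.1 p.2).Infinite},
      ∃ q : {p : V × V // T.Adj p.1 p.2 ∧ (Br T p.1 p.2).Infinite},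
        q.1.1 = p.1.2 ∧ q.1.2 ≠ p.1.1 := by
    rintro ⟨⟨u, w⟩, h1, h2⟩
    obtain ⟨w', h3, h4, h5⟩ := koenig h hlf h2
    exact ⟨⟨⟨w, w'⟩, h3, h5⟩, rfl, h4⟩
  choose f hf1 hf2 using step
  let s : ℕ → {p : V × V // T.Adj p.1 p.2 ∧ (Br T p.1 p.2).Infinite} :=
    fun n => Nat.rec ⟨(a, b), hab, hi⟩ (fun _ p => f p) n
  have hs : ∀ n, s (n + 1) = f (s n) := fun n => rfl
  refine ⟨fun n => (s n).1.1, rfl, ?_, ?_, ?_⟩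
  · exact hf1 _
  · intro n
    have := (s n).2.1
    rw [← hf1, ← hs] at this
    exact this
  · intro n
    have := hf2 (s n)
    rw [← hs, ← hf1] at this
    exact this

lemma line_dist (h : T.IsTree) {v : ℤ → V} (hv : ∀ n, T.Adj (v n) (v (n + 1)))
    (hnb : ∀ n, v (n + 2) ≠ v n) (m : ℤ) (k : ℕ) :
    T.dist (v m) (v (m + k)) = k ∧ T.dist (v m) (v (m + k + 1)) = k + 1 := by
  induction k with
  | zero => simpa using hv m
  | succ k ih =>
    have e : m + ((k + 1 : ℕ) : ℤ) = m + k + 1 := by push_cast; ring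
    rw [e]
    refine ⟨ih.2, ?_⟩
    rcases adj_dist h (v m) (hv (m + k + 1)) with h8 | h8
    · exfalso
      refine hnb (m + k) (pred_unique h (o := v m) ?_ (hv (m + k)) ?_ ?_)
      · have := (hv (m + k + 1)).symm
        rwa [add_assoc (m + k : ℤ) 1 1] at this
      · rw [add_assoc (m + k : ℤ) 1 1] at h8
        exact h8
      · omega
    · rw [h8, ih.2]

lemma line_inj (h : T.IsTree) {v : ℤ → V} (hv : ∀ n, T.Adj (v n) (v (n + 1)))
    (hnb : ∀ n, v (n + 2) ≠ v n) : Function.Injective v := by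
  have key : ∀ m n : ℤ, m ≤ n → v m = v n → m = n := by
    intro m n hmn he
    obtain ⟨k, rfl⟩ := Int.le.dest hmn
    have := (line_dist h hv hnb m k).1
    rw [← he, dist_self] at this
    omega
  intro m n he
  rcases le_total m n with hl | hl
  · exact key _ _ hl he
  · exact (key _ _ hl he.symm).symm

lemma line_exists (h : T.IsTree) (hlf : ∀ v, (T.neighborSet v).Finite) (h2 : T.TwoEnded) :
    ∃ v : ℤ → V, Function.Injective v ∧ ∀ n, T.Adj (v n) (v (n + 1)) := by
  obtain ⟨a, b, hab, i1, i2⟩ := trunk_edge h hlf h2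
  obtain ⟨r, r0, r1, ra, rb⟩ := ray h hlf hab i1
  obtain ⟨s, s0, s1, sa, sb⟩ := ray h hlf hab.symm i2
  let v : ℤ → V := fun n => match n with
    | Int.ofNat n => r n
    | Int.negSucc n => s (n + 2)
  have hv : ∀ n, T.Adj (v n) (v (n + 1)) := by
    rintro (n | n)
    · exact ra n
    · rcases n with _ | n
      · change T.Adj (s 2) (r 0)
        rw [r0, ← s1]
        exact (sa 1).symm
      · exact (sa (n + 2)).symm
  refine ⟨v, line_inj h hv ?_, hv⟩
  rintro (n | n)
  · exact rb n
  · rcases n with _ | _ | n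
    · change r 1 ≠ s 2
      rw [r1, ← s0]
      exact (sb 0).symm
    · change r 0 ≠ s 3
      rw [r0, ← s1]
      exact (sb 1).symm
    · exact (sb (n + 2)).symm

lemma line_Br (h : T.IsTree) {v : ℤ → V} (hi : Function.Injective v)
    (hv : ∀ n, T.Adj (v n) (v (n + 1))) (n : ℤ) : (Br T (v n) (v (n + 1))).Infinite := by
  have hnb : ∀ n, v (n + 2) ≠ v n := fun n e => by
    have := hi e
    omega
  refine Set.infinite_of_injective_forall_mem (f := fun k : ℕ => v (n + 1 + k)) ?_ ?_
  · intro k l e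
    have := hi e
    omega
  · intro k
    rw [mem_Br, (line_dist h hv hnb (n + 1) k).1, ← (line_dist h hv hnb n k).2]
    congr 2
    ring

lemma line_Br' (h : T.IsTree) {v : ℤ → V} (hi : Function.Injective v)
    (hv : ∀ n, T.Adj (v n) (v (n + 1))) (n : ℤ) : (Br T (v n) (v (n - 1))).Infinite := by
  have := line_Br h (v := fun n => v (-n)) (fun a b e => by simpa using hi e) (fun n => by
    have := (hv (-(n + 1))).symm
    simpa using this) (-n)
  simpa [sub_eq_add_neg, add_comm] using this

lemma adj_pred {v : ℤ → V} (hv : ∀ n, T.Adj (v n) (v (n + 1))) (n : ℤ) :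
    T.Adj (v n) (v (n - 1)) := by
  simpa using (hv (n - 1)).symm

lemma absorb (h : T.IsTree) (h2 : T.TwoEnded) {v : ℤ → V} (hi : Function.Injective v)
    (hv : ∀ n, T.Adj (v n) (v (n + 1))) : ∀ k x x', T.Adj x' x → T.dist (v 0) x' = k →
      T.dist (v 0) x = k + 1 → (Br T x' x).Infinite → x ∈ Set.range v := by
  intro k
  have main : ∀ x x', T.Adj x' x → (Br T x' x).Infinite → x' ∈ Set.range v →
      x ∈ Set.range v := by
    rintro x x' hx hinf ⟨n, rfl⟩
    rcases three h h2 (hv n) (adj_pred hv n) hx (line_Br h hi hv n) (line_Br' h hi hv n) hinf with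
      e | e | e
    · have := hi e
      omega
    · exact ⟨_, e⟩
    · exact ⟨_, e⟩
  induction k with
  | zero =>
    intro x x' hx h3 h4 h5
    exact main x x' hx h5 ⟨0, h.1.dist_eq_zero_iff.1 h3⟩
  | succ k ih =>
    intro x x' hx h3 h4 h5
    refine main x x' hx h5 ?_
    obtain ⟨z, hz, hzd⟩ := pred_exists h (o := v 0) (y := x') (by
      intro e
      rw [← e, dist_self] at h3
      omega)
    refine ih x' z hz (by omega) h3 (h5.mono (Br_sub h hz hx ?_))
    rintro rfl
    omega

lemma range_sub (h : T.IsTree) (h2 : T.TwoEnded) {v v' : ℤ → V} (hi : Function.Injective v)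
    (hv : ∀ n, T.Adj (v n) (v (n + 1))) (hi' : Function.Injective v')
    (hv' : ∀ n, T.Adj (v' n) (v' (n + 1))) : Set.range v' ⊆ Set.range v := by
  rintro _ ⟨n, rfl⟩
  by_cases hne : v 0 = v' n
  · exact ⟨0, hne⟩
  obtain ⟨z, hz, hzd⟩ := pred_exists h hne
  refine absorb h h2 hi hv _ (v' n) z hz rfl hzd ?_
  by_cases hc : v' (n + 1) = z
  · refine (line_Br' h hi' hv' n).mono (Br_sub h hz (adj_pred hv' n) ?_)
    rw [← hc]
    intro e
    have := hi' e
    omega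
  · exact (line_Br h hi' hv' n).mono (Br_sub h hz (hv' n) hc)

lemma comp_finite (h : T.IsTree) (h2 : T.TwoEnded) {v : ℤ → V} (hi : Function.Injective v)
    (hv : ∀ n, T.Adj (v n) (v (n + 1))) (y : ↥((Set.range v)ᶜ : Set V)) :
    {z : ↥((Set.range v)ᶜ : Set V) | (T.induce (Set.range v)ᶜ).Reachable z y}.Finite := by
  set K := {z : ↥((Set.range v)ᶜ : Set V) | (T.induce (Set.range v)ᶜ).Reachable z y} with hK
  obtain ⟨k, hk, hmin⟩ := exists_minimalFor_of_wellFoundedLT (· ∈ K)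
    (fun z : ↥((Set.range v)ᶜ : Set V) => T.dist (v 0) z) ⟨y, Reachable.refl y⟩
  have hne : v 0 ≠ k := fun e => k.2 ⟨0, e⟩
  obtain ⟨z, hz, hzd⟩ := pred_exists h hne
  have hzr : z ∈ Set.range v := by
    by_contra hc
    have hzK : (⟨z, hc⟩ : ↥((Set.range v)ᶜ : Set V)) ∈ K := by
      refine Reachable.trans (Adj.reachable ?_) hk
      simpa using hz
    have := hmin hzK (by simp only; omega)
    simp only at this
    omega
  by_contra hinf
  have hinf : K.Infinite := hinf
  refine k.2 (absorb h h2 hi hv _ k z hz rfl hzd ?_)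
  refine (hinf.image (f := Subtype.val) Subtype.val_injective.injOn).mono ?_
  rintro _ ⟨x, hx, rfl⟩
  refine reach_mem (A := Br T z k) (fun a ha b hb hab => ?_) (hk.trans hx.symm) (Br_self hz)
  by_contra hc
  have := (Br_cross h hz ha hab hc).2
  subst this
  exact hb hzr

end TrunkAux

/-- A locally finite tree with exactly two ends has a doubly infinite self-avoiding
path (the trunk), whose vertex set is the same for every such path, and deleting the
trunk leaves only finite connected components. -/
theorem two_ended_tree_trunk {V : Type*} (T : SimpleGraph V)
    (htree : T.IsTree)
    (hlf : ∀ v, (T.neighborSet v).Finite)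
    (htwo : T.TwoEnded) :
    ∃ v : ℤ → V, Function.Injective v ∧ (∀ n : ℤ, T.Adj (v n) (v (n + 1))) ∧
      (∀ v' : ℤ → V, Function.Injective v' → (∀ n : ℤ, T.Adj (v' n) (v' (n + 1))) →
        Set.range v' = Set.range v) ∧
      (∀ y : ↥((Set.range v)ᶜ : Set V),
        {z : ↥((Set.range v)ᶜ : Set V) |
          (T.induce (Set.range v)ᶜ).Reachable z y}.Finite) := by
  obtain ⟨v, hi, hv⟩ := TrunkAux.line_exists htree hlf htwo
  refine ⟨v, hi, hv, fun v' hi' hv' => ?_, TrunkAux.comp_finite htree htwo hi hv⟩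
  exact (TrunkAux.range_sub htree htwo hi hv hi' hv').antisymm
    (TrunkAux.range_sub htree htwo hi' hv' hi hv)
end

section
/- Let S be a finite non-equidistant subset of a metric space with at least two points, and let f : S → S be the nearest-neighbor map. Consider the equivalence relation on S generated by relating x to f(x) for every x (whose classes are the weakly connected components of the functional graph of f). Then every equivalence class contains exactly one mutually closest pair: in each class there exist distinct a, b with f(a) = b and f(b) = a, and if {a, b} and {c, d} are two such pairs in the same class then {a, b} = {c, d}. -/
theorem eqvGen_iterate {X : Type*} (S : Set X) (f : X → X) {u v : X}
    (h : Relation.EqvGen (fun u v => u ∈ S ∧ v = f u) u v) :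
    ∃ m n : ℕ, f^[m] u = f^[n] v := by
  induction h with
  | rel u v h => exact ⟨1, 0, by simp [h.2]⟩
  | refl u => exact ⟨0, 0, rfl⟩
  | symm u v _ ih => obtain ⟨m, n, h⟩ := ih; exact ⟨n, m, h.symm⟩
  | trans u v w _ _ h1 h2 =>
    obtain ⟨m, n, h1⟩ := h1
    obtain ⟨k, l, h2⟩ := h2
    refine ⟨k + m, n + l, ?_⟩
    rw [Function.iterate_add_apply, h1, ← Function.iterate_add_apply, add_comm k n,
      Function.iterate_add_apply, h2, ← Function.iterate_add_apply]

theorem iterate_pair {X : Type*} (f : X → X) {a b : X} (h1 : f a = b) (h2 : f b = a) (n : ℕ) :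
    f^[n] a = a ∨ f^[n] a = b := by
  induction n with
  | zero => left; rfl
  | succ n ih =>
    rw [Function.iterate_succ_apply']
    rcases ih with h | h <;> rw [h] <;> simp [h1, h2]

/-- In a finite non-equidistant set `S`, each class of the equivalence relation
generated by relating every point to its nearest neighbor contains exactly one
mutually closest pair. -/
theorem nearest_neighbor_component_unique_pair {X : Type*} [MetricSpace X] (S : Set X)
    (hfin : S.Finite) (h2 : ∃ x ∈ S, ∃ y ∈ S, x ≠ y) (hne : NonEquidistant S)
    (f : X → X)
    (hfS : ∀ x ∈ S, f x ∈ S)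
    (hfne : ∀ x ∈ S, f x ≠ x)
    (hfmin : ∀ x ∈ S, ∀ z ∈ S, z ≠ x → dist x (f x) ≤ dist x z)
    (x : X) (hx : x ∈ S) :
    ∃ a ∈ S, ∃ b ∈ S,
      Relation.EqvGen (fun u v => u ∈ S ∧ v = f u) x a ∧
      a ≠ b ∧ f a = b ∧ f b = a ∧
      (∀ c ∈ S, ∀ d ∈ S,
        Relation.EqvGen (fun u v => u ∈ S ∧ v = f u) x c →
        c ≠ d → f c = d → f d = c → ({c, d} : Set X) = {a, b}) := by
  obtain ⟨a, ⟨haS, hxa⟩, hmin⟩ := Set.exists_min_image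
    {u | u ∈ S ∧ Relation.EqvGen (fun u v => u ∈ S ∧ v = f u) x u} (fun u => dist u (f u))
    (hfin.subset fun u hu => hu.1) ⟨x, hx, Relation.EqvGen.refl x⟩
  have hbS := hfS a haS
  have hab := hfne a haS
  have hfb : f (f a) = a := by
    by_contra hcon
    have h1 : dist a (f a) ≤ dist (f a) (f (f a)) :=
      hmin (f a) ⟨hbS, hxa.trans _ _ _ (Relation.EqvGen.rel _ _ ⟨haS, rfl⟩)⟩
    have h2 := hfmin (f a) hbS a haS hab.symm
    rw [dist_comm (f a) a] at h2
    refine hne a haS (f a) hbS (f a) hbS (f (f a)) (hfS _ hbS) hab.symm (hfne _ hbS).symm ?_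
      (le_antisymm h1 h2)
    intro h
    have : a ∈ ({f a, f (f a)} : Set X) := h ▸ (by simp)
    rcases this with h | h
    · exact hab h.symm
    · exact hcon h.symm
  refine ⟨a, haS, f a, hbS, hxa, hab.symm, rfl, hfb, ?_⟩
  intro c _ d _ hxc _ hcd hdc
  obtain ⟨m, n, hmn⟩ := eqvGen_iterate S f ((hxa.symm _ _).trans _ _ _ hxc)
  rcases iterate_pair f rfl hfb m with h | h <;> rcases iterate_pair f hcd hdc n with h' | h' <;>
    rw [h, h'] at hmn
  · rw [← hcd, hmn]
  · subst hmn; rw [hdc, Set.pair_comm]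
  · subst hmn; rw [← hcd, hfb, Set.pair_comm]
  · have : c = a := by rw [← hdc, ← hmn, hfb]
    rw [← hmn, this]
end
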